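/- arXiv:2509.15477 — 8 statements merged into one kernel-verified Lean document; each statement's English description precedes it below -/
import Mathlib

section
/- Let f, g : ℝ → ℝ be infinitely differentiable (C^∞) functions and suppose g is d-even at 0. Then the composition f ∘ g is d-even at 0, i.e. for every k ∈ ℕ the iterated derivative of order 2k+1 of f ∘ g at the point 0 vanishes. -/
/-- If `f` and `g` are smooth and `g` is d-even at `0` (all odd-order derivatives of `g`
vanish at `0`), then `f ∘ g` is d-even at `0`. -/
theorem comp_dEven_of_dEven (f g : ℝ → ℝ) (hf : ContDiff ℝ (⊤ : ℕ∞) f) (hg : ContDiff ℝ (⊤ : ℕ∞) g)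
    (hge : ∀ k : ℕ, iteratedDeriv (2 * k + 1) g 0 = 0) :
    ∀ k : ℕ, iteratedDeriv (2 * k + 1) (f ∘ g) 0 = 0 := by
  intro k
  induction k using Nat.strong_induction_on generalizing f with
  | _ k ih =>
    obtain ⟨hf_diff, hf'⟩ := contDiff_infty_iff_deriv.mp hf
    obtain ⟨hg_diff, hg'⟩ := contDiff_infty_iff_deriv.mp hg
    have hderiv : deriv (f ∘ g) = (deriv f ∘ g) * deriv g :=
      funext fun x => deriv_comp x (hf_diff (g x)) (hg_diff x)
    rw [iteratedDeriv_succ', hderiv,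
      iteratedDeriv_mul (contDiff_infty.mp (hf'.comp hg) _).contDiffAt
        (contDiff_infty.mp hg' _).contDiffAt]
    refine Finset.sum_eq_zero fun i hi => ?_
    rw [Finset.mem_range] at hi
    obtain ⟨m, rfl | rfl⟩ := i.even_or_odd'
    · rw [← iteratedDeriv_succ', ← Nat.mul_sub, hge, mul_zero]
    · rw [ih m (by omega) (deriv f) hf', mul_zero, zero_mul]
end

section
/- Let f, g : ℝ → ℝ be infinitely differentiable (C^∞) functions. If f is d-even at 0, g is d-odd at 0, and g 0 = 0, then the composition f ∘ g is d-even at 0, i.e. for every k ∈ ℕ the iterated derivative of order 2k+1 of f ∘ g at 0 vanishes. -/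
/-- The sizes of the parts of an ordered finpartition of `Fin n` add up to `n`. -/
theorem OrderedFinpartition.sum_partSize_eq {n : ℕ} (c : OrderedFinpartition n) :
    ∑ j, c.partSize j = n := by
  simpa using Fintype.card_congr c.equivSigma

/-- An ordered finpartition of `Fin n` all of whose parts have odd size has a number of parts
of the same parity as `n`. -/
theorem OrderedFinpartition.odd_length_of_odd_partSize {n : ℕ} (c : OrderedFinpartition n)
    (hn : Odd n) (hc : ∀ j, Odd (c.partSize j)) : Odd c.length := by
  rw [← c.sum_partSize_eq, Finset.odd_sum_iff_odd_card_odd] at hn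
  simpa [hc] using hn

/-- If `f` is smooth and d-even at `0`, `g` is smooth and d-odd at `0` (with `g 0 = 0`),
then `f ∘ g` is d-even at `0`. -/
theorem comp_dEven_of_dEven_dOdd (f g : ℝ → ℝ) (hf : ContDiff ℝ (⊤ : ℕ∞) f) (hg : ContDiff ℝ (⊤ : ℕ∞) g)
    (hfe : ∀ k : ℕ, iteratedDeriv (2 * k + 1) f 0 = 0)
    (hgo : ∀ k : ℕ, iteratedDeriv (2 * k) g 0 = 0)
    (hg0 : g 0 = 0) :
    ∀ k : ℕ, iteratedDeriv (2 * k + 1) (f ∘ g) 0 = 0 := by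
  intro k
  rw [iteratedDeriv_comp_eq_sum_orderedFinpartition hf.contDiffAt hg.contDiffAt
    (WithTop.coe_le_coe.mpr (le_top : ((2 * k + 1 : ℕ) : ℕ∞) ≤ ⊤)), hg0]
  refine Finset.sum_eq_zero fun c _ => ?_
  by_cases hc : ∀ j, Odd (c.partSize j)
  · obtain ⟨m, hm⟩ := c.odd_length_of_odd_partSize (odd_two_mul_add_one k) hc
    have h : iteratedDeriv c.length f 0 = 0 := by rw [hm, hfe]
    rw [h, zero_mul]
  · obtain ⟨j, hj⟩ := not_forall.mp hc
    obtain ⟨m, hm⟩ := even_iff_exists_two_mul.mp (Nat.not_odd_iff_even.mp hj)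
    rw [Finset.prod_eq_zero (Finset.mem_univ j) (by rw [hm, hgo]), mul_zero]
end

section
/- Let f, g : ℝ → ℝ be infinitely differentiable (C^∞) functions. If f is d-odd at 0 and g is d-odd at 0, then the composition f ∘ g is d-odd at 0, i.e. for every k ∈ ℕ the iterated derivative of order 2k of f ∘ g at 0 vanishes. -/
/-- If `f` and `g` are smooth and both d-odd at `0` (all even-order derivatives vanish at `0`),
then `f ∘ g` is d-odd at `0`. -/
theorem comp_dOdd_of_dOdd_dOdd (f g : ℝ → ℝ) (hf : ContDiff ℝ (⊤ : ℕ∞) f) (hg : ContDiff ℝ (⊤ : ℕ∞) g)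
    (hfo : ∀ k : ℕ, iteratedDeriv (2 * k) f 0 = 0)
    (hgo : ∀ k : ℕ, iteratedDeriv (2 * k) g 0 = 0) :
    ∀ k : ℕ, iteratedDeriv (2 * k) (f ∘ g) 0 = 0 := by
  intro k
  have hg0 : g 0 = 0 := by simpa using hgo 0
  have hle : ((2 * k : ℕ) : WithTop ℕ∞) ≤ ((⊤ : ℕ∞) : WithTop ℕ∞) :=
    WithTop.coe_le_coe.2 le_top
  rw [iteratedDeriv_comp_eq_sum_orderedFinpartition (n := ((⊤ : ℕ∞) : WithTop ℕ∞))
    hf.contDiffAt hg.contDiffAt hle, hg0]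
  refine Finset.sum_eq_zero fun c _ => ?_
  by_cases hlen : Even c.length
  · obtain ⟨m, hm⟩ := even_iff_exists_two_mul.mp hlen
    simp [hm, hfo]
  · obtain ⟨i, hi⟩ : ∃ i, Even (c.partSize i) := by
      by_contra! hodd
      have hsum : ∑ i, c.partSize i = 2 * k := by
        simpa using Fintype.card_congr c.equivSigma
      have hparts := Finset.even_sum_iff_even_card_odd (s := Finset.univ) c.partSize
      rw [Finset.filter_true_of_mem fun i _ => Nat.not_even_iff_odd.mp (hodd i), hsum] at hparts
      exact hlen (by simpa using hparts)
    obtain ⟨m, hm⟩ := even_iff_exists_two_mul.mp hi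
    rw [Finset.prod_eq_zero (Finset.mem_univ i) (by rw [hm, hgo])]
    simp
end

section
/- Let f, g : ℝ → ℝ be infinitely differentiable (C^∞) functions. Suppose f is d-odd at 0, the derivative of f at 0 is nonzero, and g is a local left inverse of f at 0, i.e. g (f x) = x for all x in some neighborhood of 0. Then g is d-odd at 0, i.e. for every k ∈ ℕ the iterated derivative of order 2k of g at 0 vanishes. -/
open scoped ContDiff in
/-- If `v` has a nonzero value and vanishing odd-order derivatives at `0`, then the derivatives of
`u` at `0` whose order has a given parity vanish as soon as those of `u * v` do. -/
theorem iteratedDeriv_eq_zero_of_mul_of_parity {u v : ℝ → ℝ} (hu : ContDiff ℝ ∞ u)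
    (hv : ContDiff ℝ ∞ v) (hv0 : v 0 ≠ 0) (hvo : ∀ n, n % 2 = 1 → iteratedDeriv n v 0 = 0)
    (p : ℕ) (huv : ∀ n, n % 2 = p → iteratedDeriv n (u * v) 0 = 0) :
    ∀ n, n % 2 = p → iteratedDeriv n u 0 = 0 := by
  intro n
  induction n using Nat.strong_induction_on with
  | _ n ih =>
    intro hn
    have h := huv n hn
    rw [iteratedDeriv_mul (hu.contDiffAt.of_le (by exact_mod_cast le_top))
      (hv.contDiffAt.of_le (by exact_mod_cast le_top)), Finset.sum_range_succ,
      Finset.sum_eq_zero] at h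
    · simpa [hv0] using h
    · intro i hi
      have hi := Finset.mem_range.mp hi
      rcases Nat.mod_two_eq_zero_or_one (n - i) with h0 | h1
      · rw [ih i hi (by omega)]
        simp
      · rw [hvo _ h1]
        simp

open scoped ContDiff in
/-- If `f` is d-odd at `0` with `deriv f 0 ≠ 0` and the derivatives of `h ∘ f` at `0` of a given
parity vanish, then the derivatives of `deriv h ∘ f` at `0` of the other parity vanish. -/
theorem iteratedDeriv_deriv_comp_eq_zero_of_parity {f h : ℝ → ℝ} (hf : ContDiff ℝ ∞ f)
    (hh : ContDiff ℝ ∞ h) (hfo : ∀ k : ℕ, iteratedDeriv (2 * k) f 0 = 0) (hf' : deriv f 0 ≠ 0)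
    {p : ℕ} (hp : p < 2) (hhf : ∀ n, n % 2 = p → iteratedDeriv n (h ∘ f) 0 = 0) :
    ∀ n, n % 2 = (p + 1) % 2 → iteratedDeriv n (deriv h ∘ f) 0 = 0 := by
  have hdf : ContDiff ℝ ∞ (deriv f) := (contDiff_infty_iff_deriv.mp hf).2
  have hdh : ContDiff ℝ ∞ (deriv h) := (contDiff_infty_iff_deriv.mp hh).2
  have hchain : deriv (h ∘ f) = (deriv h ∘ f) * deriv f := by
    funext x
    exact deriv_comp x (hh.differentiable (by simp) _) (hf.differentiable (by simp) _)
  refine iteratedDeriv_eq_zero_of_mul_of_parity (hdh.comp hf) hdf hf' ?_ _ ?_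
  · intro n hn
    rw [← iteratedDeriv_succ', show n + 1 = 2 * ((n + 1) / 2) by omega]
    exact hfo _
  · intro n hn
    rw [← hchain, ← iteratedDeriv_succ']
    exact hhf _ (by omega)

/-- If `f` is smooth, d-odd at `0`, with `deriv f 0 ≠ 0`, and `g` is a smooth local left
inverse of `f` near `0`, then `g` is d-odd at `0`. -/
theorem localInverse_dOdd_of_dOdd (f g : ℝ → ℝ) (hf : ContDiff ℝ (⊤ : ℕ∞) f) (hg : ContDiff ℝ (⊤ : ℕ∞) g)
    (hfo : ∀ k : ℕ, iteratedDeriv (2 * k) f 0 = 0)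
    (hf' : deriv f 0 ≠ 0)
    (hinv : ∀ᶠ x in nhds (0 : ℝ), g (f x) = x) :
    ∀ k : ℕ, iteratedDeriv (2 * k) g 0 = 0 := by
  have hf0 : f 0 = 0 := by simpa using hfo 0
  have key : ∀ (k : ℕ) (h : ℝ → ℝ), ContDiff ℝ (⊤ : ℕ∞) h →
      (∀ n, n % 2 = 0 → iteratedDeriv n (h ∘ f) 0 = 0) → iteratedDeriv (2 * k) h 0 = 0 := by
    intro k
    induction k with
    | zero =>
      intro h _ hhf
      simpa [hf0] using hhf 0 rfl
    | succ k ih =>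
      intro h hh hhf
      have hh' := (contDiff_infty_iff_deriv.mp hh).2
      rw [show 2 * (k + 1) = 2 * k + 1 + 1 by ring, iteratedDeriv_succ', iteratedDeriv_succ']
      exact ih _ (contDiff_infty_iff_deriv.mp hh').2
        (iteratedDeriv_deriv_comp_eq_zero_of_parity hf hh' hfo hf' one_lt_two
          (iteratedDeriv_deriv_comp_eq_zero_of_parity hf hh hfo hf' two_pos hhf))
  refine fun k => key k g hg fun n hn => ?_
  have hid : g ∘ f =ᶠ[nhds 0] id := hinv
  rw [hid.iteratedDeriv_eq n, iteratedDeriv_id]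
  split_ifs <;> first | rfl | omega
end

section
/- Let f : ℝ → ℝ be an infinitely differentiable (C^∞) function that is d-even at 0. Then the function x ↦ f ‖x‖ on three-dimensional Euclidean space is infinitely differentiable; that is, the map (fun x : EuclideanSpace ℝ (Fin 3) => f ‖x‖) is ContDiff ℝ ⊤. -/
open Set Filter Topology in
/-- Differentiation under the integral sign for the moments `∫ t in 0..1, t ^ j * h (t * r)` of a
continuously differentiable function `h`. -/
theorem hasDerivAt_integral_pow_mul_comp_mul {h : ℝ → ℝ} (hh : ContDiff ℝ 1 h) (j : ℕ) (r : ℝ) :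
    HasDerivAt (fun r : ℝ => ∫ t in (0 : ℝ)..1, t ^ j * h (t * r))
      (∫ t in (0 : ℝ)..1, t ^ (j + 1) * deriv h (t * r)) r := by
  have hc : Continuous h := hh.continuous
  have hc' : Continuous (deriv h) := hh.continuous_deriv le_rfl
  obtain ⟨C, hC⟩ := ((isCompact_Icc (a := (0 : ℝ)) (b := 1)).prod
    (isCompact_closedBall r 1)).exists_bound_of_continuousOn
    (f := fun p : ℝ × ℝ => p.1 ^ (j + 1) * deriv h (p.1 * p.2))
    (Continuous.continuousOn (by fun_prop))
  refine (intervalIntegral.hasDerivAt_integral_of_dominated_loc_of_deriv_le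
    (F := fun r t => t ^ j * h (t * r)) (F' := fun r t => t ^ (j + 1) * deriv h (t * r))
    (bound := fun _ => C) (Metric.closedBall_mem_nhds r one_pos) ?_ ?_ ?_ ?_ ?_ ?_).2
  · exact Eventually.of_forall fun x => Continuous.aestronglyMeasurable (by fun_prop)
  · exact Continuous.intervalIntegrable (by fun_prop) _ _
  · exact Continuous.aestronglyMeasurable (by fun_prop)
  · refine Eventually.of_forall fun t ht x hx => hC (t, x) ⟨?_, hx⟩
    rw [uIoc_of_le zero_le_one] at ht
    exact ⟨ht.1.le, ht.2⟩
  · exact intervalIntegrable_const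
  · refine Eventually.of_forall fun t _ x _ => ?_
    have hd : HasDerivAt h (deriv h (t * x)) (t * x) :=
      (hh.differentiable one_ne_zero _).hasDerivAt
    have hm : HasDerivAt (fun x : ℝ => t * x) t x := by
      simpa using (hasDerivAt_id x).const_mul t
    refine ((hd.comp x hm).const_mul (t ^ j)).congr_deriv ?_
    ring

theorem iteratedDeriv_integral_comp_mul {h : ℝ → ℝ} (hh : ContDiff ℝ (⊤ : ℕ∞) h) (k : ℕ) :
    iteratedDeriv k (fun r : ℝ => ∫ t in (0 : ℝ)..1, h (t * r)) =
      fun r => ∫ t in (0 : ℝ)..1, t ^ k * iteratedDeriv k h (t * r) := by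
  induction k with
  | zero => simp
  | succ k ih =>
    rw [iteratedDeriv_succ, ih, iteratedDeriv_succ]
    funext r
    refine (hasDerivAt_integral_pow_mul_comp_mul ?_ k r).deriv
    exact iteratedDeriv_eq_iterate (f := h) (n := k) ▸ (hh.iterate_deriv k).of_le (by simp)

theorem contDiff_integral_comp_mul {h : ℝ → ℝ} (hh : ContDiff ℝ (⊤ : ℕ∞) h) :
    ContDiff ℝ (⊤ : ℕ∞) (fun r : ℝ => ∫ t in (0 : ℝ)..1, h (t * r)) := by
  refine contDiff_of_differentiable_iteratedDeriv fun k _ r => ?_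
  rw [iteratedDeriv_integral_comp_mul hh]
  refine (hasDerivAt_integral_pow_mul_comp_mul ?_ k r).differentiableAt
  exact iteratedDeriv_eq_iterate (f := h) (n := k) ▸ (hh.iterate_deriv k).of_le (by simp)

/-- Hadamard's lemma for the derivative of a smooth function that is d-even at `0`. -/
theorem exists_contDiff_dEven_deriv_eq_mul {f : ℝ → ℝ} (hf : ContDiff ℝ (⊤ : ℕ∞) f)
    (hfe : ∀ k : ℕ, iteratedDeriv (2 * k + 1) f 0 = 0) :
    ∃ g : ℝ → ℝ, ContDiff ℝ (⊤ : ℕ∞) g ∧ (∀ k : ℕ, iteratedDeriv (2 * k + 1) g 0 = 0) ∧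
      ∀ r, deriv f r = g r * r := by
  have hf' : ContDiff ℝ (⊤ : ℕ∞) (deriv f) := (contDiff_infty_iff_deriv.1 hf).2
  have hf'' : ContDiff ℝ (⊤ : ℕ∞) (deriv (deriv f)) := (contDiff_infty_iff_deriv.1 hf').2
  refine ⟨fun r => ∫ t in (0 : ℝ)..1, deriv (deriv f) (t * r), contDiff_integral_comp_mul hf'',
    fun k => ?_, fun r => ?_⟩
  · rw [iteratedDeriv_integral_comp_mul hf'']
    have h0 : iteratedDeriv (2 * k + 1) (deriv (deriv f)) 0 = 0 := by
      rw [← iteratedDeriv_succ', ← iteratedDeriv_succ']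
      exact hfe (k + 1)
    simp [h0]
  · have h0 : deriv f 0 = 0 := by simpa using hfe 0
    have hd : Differentiable ℝ (deriv f) := hf'.differentiable (by simp)
    have hint := intervalIntegral.integral_deriv_eq_sub (f := deriv f) (a := 0) (b := r)
      (fun x _ => hd x) (hf''.continuous.intervalIntegrable _ _)
    have hsub := intervalIntegral.mul_integral_comp_mul_right
      (f := deriv (deriv f)) (a := 0) (b := 1) r
    simp only [zero_mul, one_mul] at hsub
    rw [mul_comm, hsub, hint, h0, sub_zero]

section Norm

variable {E : Type*} [NormedAddCommGroup E] [InnerProductSpace ℝ E]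

open Asymptotics in
/-- The gradient of the radial function `x ↦ f ‖x‖` is `x ↦ g ‖x‖ • x` if `f' r = g r * r`. -/
theorem hasFDerivAt_comp_norm_of_deriv_eq_mul {f g : ℝ → ℝ} (hf : Differentiable ℝ f)
    (hg : ∀ r, deriv f r = g r * r) (x : E) :
    HasFDerivAt (fun x : E => f ‖x‖) (g ‖x‖ • innerSL ℝ x) x := by
  rcases eq_or_ne x 0 with rfl | hx
  · have h0 : HasDerivAt f 0 0 := by simpa [hg] using (hf 0).hasDerivAt
    rw [hasDerivAt_iff_isLittleO_nhds_zero] at h0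
    rw [hasFDerivAt_iff_isLittleO_nhds_zero]
    simpa [Function.comp_def] using
      (h0.comp_tendsto (tendsto_norm_zero (E := E))).of_norm_right
  · have hnorm : HasFDerivAt (fun x : E => ‖x‖) (‖x‖⁻¹ • innerSL ℝ x) x := by
      have hs := (hasStrictFDerivAt_norm_sq x).hasFDerivAt.sqrt
        (pow_ne_zero 2 (norm_ne_zero_iff.2 hx))
      simp only [Real.sqrt_sq (norm_nonneg _)] at hs
      refine hs.congr_fderiv ?_
      ext y
      simp
      field_simp
    have hd : HasDerivAt f (g ‖x‖ * ‖x‖) ‖x‖ := hg ‖x‖ ▸ (hf ‖x‖).hasDerivAt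
    refine (hd.comp_hasFDerivAt x hnorm).congr_fderiv ?_
    rw [smul_smul, mul_assoc, mul_inv_cancel₀ (norm_ne_zero_iff.2 hx), mul_one]

theorem contDiff_nat_comp_norm_of_dEven (n : ℕ) {f : ℝ → ℝ} (hf : ContDiff ℝ (⊤ : ℕ∞) f)
    (hfe : ∀ k : ℕ, iteratedDeriv (2 * k + 1) f 0 = 0) :
    ContDiff ℝ n (fun x : E => f ‖x‖) := by
  induction n generalizing f with
  | zero => exact contDiff_zero.2 (hf.continuous.comp continuous_norm)
  | succ n ih =>
    obtain ⟨g, hg, hge, hfg⟩ := exists_contDiff_dEven_deriv_eq_mul hf hfe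
    push_cast
    rw [contDiff_succ_iff_hasFDerivAt]
    exact ⟨fun x => g ‖x‖ • innerSL ℝ x, (ih hg hge).smul (innerSL ℝ).contDiff,
      hasFDerivAt_comp_norm_of_deriv_eq_mul (hf.differentiable (by simp)) hfg⟩

end Norm


/-- If `f : ℝ → ℝ` is smooth and d-even at `0`, then `x ↦ f ‖x‖` is smooth on
three-dimensional Euclidean space. -/
theorem contDiff_comp_norm_of_dEven (f : ℝ → ℝ) (hf : ContDiff ℝ (⊤ : ℕ∞) f)
    (hfe : ∀ k : ℕ, iteratedDeriv (2 * k + 1) f 0 = 0) :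
    ContDiff ℝ (⊤ : ℕ∞) (fun x : EuclideanSpace ℝ (Fin 3) => f ‖x‖) := by
  exact contDiff_infty.2 fun n => contDiff_nat_comp_norm_of_dEven n hf hfe
end

section
/- For all real numbers m and b₀, if 4*b₀ - m^2 - 2*m - 4 = 0 and 16*b₀^2 - 32*b₀ + m^4 - 4*m^3 + 12*m^2 + 16 = 0, then m = 0 and b₀ = 1. -/
/-- If the leading divergent coefficients of the Ricci and Kretschmann scalars (with `n = 0`)
both vanish, then `m = 0` and `b₀ = 1`. -/
theorem vanishing_forces_m_zero_b_one (m b₀ : ℝ)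
    (h₁ : 4 * b₀ - m ^ 2 - 2 * m - 4 = 0)
    (h₂ : 16 * b₀ ^ 2 - 32 * b₀ + m ^ 4 - 4 * m ^ 3 + 12 * m ^ 2 + 16 = 0) :
    m = 0 ∧ b₀ = 1 := by
  have key : 2 * m ^ 2 * (m ^ 2 + 8) = 0 := by
    linear_combination h₂ - (4 * b₀ - 4 + m ^ 2 + 2 * m) * h₁
  have hm : m = 0 := by
    have h : m ^ 2 + 8 ≠ 0 := by positivity
    simpa [h] using key
  subst hm
  exact ⟨rfl, by linarith⟩
end

section
/- Let N ∈ ℕ and x, y ∈ ℝ, and define the real numbers: αN = -(2*N+1)*(N+1)*x, βN = (2*N+1)*(-N*x + y), γN = (-(2*N+1)*x + (2*N+3)*y)/2; then β̃ = (βN + 2*γN)/3 and γ̃ = (γN - βN)/3; then α₀ = (2*N)! * αN, β₀ = (2*N)! * β̃ + (2*((N+1)/(2*N-1)) * (2*N)!) * γ̃, γ₀ = (2*N)! * β̃ - ((N+1)/(2*N-1)) * (2*N)! * γ̃ (here 2*N-1 is interpreted in ℝ, so it equals -1 when N = 0). Then α₀^2 + β₀^2 + 2*γ₀^2 = (1/2)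 * (N+1)^2 * ((2*N)!)^2 * (11*y^2 + 3*(2*N+1)*((2*N+1)*x - 2*y)*x). -/
open scoped Nat

/-- The coefficient of the `r⁻²` divergence of `□^N R^μ_ν □^N R^ν_μ`, expressed in terms of
`x = a_{2N+1}/a₀` and `y = b_{2N+1}`: a purely algebraic identity in `ℝ`. -/
theorem box_ricci_squared_coefficient (N : ℕ) (x y : ℝ)
    (αN βN γN βt γt α₀ β₀ γ₀ : ℝ)
    (hαN : αN = -(2 * (N : ℝ) + 1) * ((N : ℝ) + 1) * x)
    (hβN : βN = (2 * (N : ℝ) + 1) * (-(N : ℝ) * x + y))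
    (hγN : γN = (-(2 * (N : ℝ) + 1) * x + (2 * (N : ℝ) + 3) * y) / 2)
    (hβt : βt = (βN + 2 * γN) / 3)
    (hγt : γt = (γN - βN) / 3)
    (hα₀ : α₀ = ((2 * N)! : ℝ) * αN)
    (hβ₀ : β₀ = ((2 * N)! : ℝ) * βt + (2 * (((N : ℝ) + 1) / (2 * (N : ℝ) - 1)) * ((2 * N)! : ℝ)) * γt)
    (hγ₀ : γ₀ = ((2 * N)! : ℝ) * βt - (((N : ℝ) + 1) / (2 * (N : ℝ) - 1)) * ((2 * N)! : ℝ) * γt) :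
    α₀ ^ 2 + β₀ ^ 2 + 2 * γ₀ ^ 2 =
      (1 / 2) * ((N : ℝ) + 1) ^ 2 * (((2 * N)! : ℝ)) ^ 2 *
        (11 * y ^ 2 + 3 * (2 * (N : ℝ) + 1) * ((2 * (N : ℝ) + 1) * x - 2 * y) * x) := by
  have hne : 2 * (N : ℝ) - 1 ≠ 0 := by
    intro h
    have h' : ((2 * N : ℕ) : ℝ) = ((1 : ℕ) : ℝ) := by
      push_cast
      linarith
    have := Nat.cast_injective h'
    omega
  have hγt' : ((N : ℝ) + 1) / (2 * (N : ℝ) - 1) * γt =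
      ((N : ℝ) + 1) * ((2 * (N : ℝ) + 1) * x - y) / 6 := by
    have h : γt = (2 * (N : ℝ) - 1) * (((2 * (N : ℝ) + 1) * x - y) / 6) := by
      rw [hγt, hγN, hβN]
      ring
    rw [h, ← mul_assoc, div_mul_cancel₀ _ hne, mul_div_assoc]
  have hβ : β₀ = ((2 * N)! : ℝ) * (((N : ℝ) + 1) * y) := by
    rw [hβ₀, hβt, hγN, hβN]
    linear_combination 2 * ((2 * N)! : ℝ) * hγt'
  have hγ : γ₀ = ((2 * N)! : ℝ) * (((N : ℝ) + 1) * (3 * y - (2 * (N : ℝ) + 1) * x) / 2) := by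
    rw [hγ₀, hβt, hγN, hβN]
    linear_combination -((2 * N)! : ℝ) * hγt'
  rw [hβ, hγ, hα₀, hαN]
  ring
end

section
/- Let N ∈ ℕ, y ∈ ℝ, and set x = 2*y/(2*N+1). With αN, βN, γN, β̃, γ̃, α₀, β₀, γ₀ defined from x and y as follows: αN = -(2*N+1)*(N+1)*x, βN = (2*N+1)*(-N*x + y), γN = (-(2*N+1)*x + (2*N+3)*y)/2, β̃ = (βN + 2*γN)/3, γ̃ = (γN - βN)/3, α₀ = (2*N)! * αN, β₀ = (2*N)! * β̃ + (2*((N+1)/(2*N-1)) * (2*N)!) * γ̃, γ₀ = (2*N)! * β̃ - ((N+1)/(2*N-1)) * (2*N)! * γ̃ (with 2*N-1 interpreted in ℝ). Then α₀^2 + β₀^2 + 2*γ₀^2 = (11/2) * (N+1)^2 * ((2*N)!)^2 * y^2; in particular this quantity is strictly positive whenever y ≠ 0. -/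
open scoped Nat

/-- Under the relation `x = 2y/(2N+1)` (which removes the `r⁻¹` divergence of `□^N R`),
the coefficient of the `r⁻²` divergence of `□^N R^μ_ν □^N R^ν_μ` equals
`(11/2) (N+1)² ((2N)!)² y²`, which is strictly positive when `y ≠ 0`. -/
theorem box_ricci_squared_coefficient_on_shell (N : ℕ) (y : ℝ)
    (x αN βN γN βt γt α₀ β₀ γ₀ : ℝ)
    (hx : x = 2 * y / (2 * (N : ℝ) + 1))
    (hαN : αN = -(2 * (N : ℝ) + 1) * ((N : ℝ) + 1) * x)
    (hβN : βN = (2 * (N : ℝ) + 1) * (-(N : ℝ) * x + y))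
    (hγN : γN = (-(2 * (N : ℝ) + 1) * x + (2 * (N : ℝ) + 3) * y) / 2)
    (hβt : βt = (βN + 2 * γN) / 3)
    (hγt : γt = (γN - βN) / 3)
    (hα₀ : α₀ = ((2 * N)! : ℝ) * αN)
    (hβ₀ : β₀ = ((2 * N)! : ℝ) * βt + (2 * (((N : ℝ) + 1) / (2 * (N : ℝ) - 1)) * ((2 * N)! : ℝ)) * γt)
    (hγ₀ : γ₀ = ((2 * N)! : ℝ) * βt - (((N : ℝ) + 1) / (2 * (N : ℝ) - 1)) * ((2 * N)! : ℝ) * γt) :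
    α₀ ^ 2 + β₀ ^ 2 + 2 * γ₀ ^ 2 =
      (11 / 2) * ((N : ℝ) + 1) ^ 2 * (((2 * N)! : ℝ)) ^ 2 * y ^ 2 ∧
    (y ≠ 0 → 0 < α₀ ^ 2 + β₀ ^ 2 + 2 * γ₀ ^ 2) := by
  have hpos : (2 * (N : ℝ) + 1) ≠ 0 := by positivity
  have hne : (2 * (N : ℝ) - 1) ≠ 0 := by
    intro h
    have h' : 2 * N = 1 := by exact_mod_cast sub_eq_zero.mp h
    omega
  have hxy : (2 * (N : ℝ) + 1) * x = 2 * y := by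
    rw [hx]
    field_simp
  have hα : α₀ = -2 * ((2 * N)! : ℝ) * ((N : ℝ) + 1) * y := by
    rw [hα₀, hαN]
    linear_combination -((2 * N)! : ℝ) * ((N : ℝ) + 1) * hxy
  have hβt' : βt = 2 * ((N : ℝ) + 1) * y / 3 := by
    rw [hβt, hγN, hβN]
    linear_combination -((N : ℝ) + 1) / 3 * hxy
  have hγt' : γt = (2 * (N : ℝ) - 1) * y / 6 := by
    rw [hγt, hγN, hβN]
    linear_combination (2 * (N : ℝ) - 1) / 6 * hxy
  have hβ : β₀ = ((2 * N)! : ℝ) * ((N : ℝ) + 1) * y := by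
    rw [hβ₀, hβt', hγt']
    field_simp
    ring
  have hγ : γ₀ = ((2 * N)! : ℝ) * ((N : ℝ) + 1) * y / 2 := by
    rw [hγ₀, hβt', hγt']
    field_simp
    ring
  have key : α₀ ^ 2 + β₀ ^ 2 + 2 * γ₀ ^ 2 =
      (11 / 2) * ((N : ℝ) + 1) ^ 2 * (((2 * N)! : ℝ)) ^ 2 * y ^ 2 := by
    rw [hα, hβ, hγ]
    ring
  refine ⟨key, fun hy => ?_⟩
  rw [key]
  positivity
end
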